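/- Let K be a field containing a primitive m-th root of unity, F = K(x) the rational function field, and u = b₁(x)/b₂(x) with b₁, b₂ ∈ K[T] coprime, deg b₁ = m, deg b₂ = m - r, gcd(m, r) = 1, char K ∤ m. Let E = F(y) with y^m = u. Then the place at infinity of F (the pole of x) is totally ramified in E/F. -/

import Mathlib

open WithZero in
/-- The values of the monomials `a * y ^ i` with `i < m` determine `i`, if `y` has value `r`
coprime to the ramification index `m`. -/
theorem WithZero.eq_of_pow_mul_exp_pow_eq {m r : ℕ} (hmr : m.Coprime r)
    {a b : WithZero (Multiplicative ℤ)} {i j : ℕ} (hi : i < m) (hj : j < m) (ha : a ≠ 0) (hb : b ≠ 0)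
    (h : a ^ m * exp (r : ℤ) ^ i = b ^ m * exp (r : ℤ) ^ j) : i = j := by
  have h' := congrArg log h
  rw [log_mul (by simp [ha]) (by simp), log_mul (by simp [hb]) (by simp)] at h'
  simp only [log_pow, log_exp, nsmul_eq_mul] at h'
  have hdvd : (m : ℤ) ∣ r * ((i : ℤ) - j) := ⟨log b - log a, by linear_combination h'⟩
  have hmr' : IsCoprime (m : ℤ) r := Nat.isCoprime_iff_coprime.mpr hmr
  have hij := Int.eq_zero_of_abs_lt_dvd (hmr'.dvd_of_dvd_mul_left hdvd)
    (by rw [abs_lt]; constructor <;> omega)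
  omega

namespace KummerRamification

open WithZero

variable {F E : Type*} [Field F] [Field E] [Algebra F E] {m : ℕ}
  (v : Valuation F (WithZero (Multiplicative ℤ)))
  (b : Module.Basis (Fin m) F E) (r : ℕ)

/-- The candidate for the extension of `v`, when `b i = y ^ i`: the largest value among the
monomials of an element of `E`. -/
noncomputable def gauge (f : E) : WithZero (Multiplicative ℤ) :=
  Finset.univ.sup fun i : Fin m ↦ v (b.repr f i) ^ m * exp (r : ℤ) ^ (i : ℕ)

variable {v b r}

theorem le_gauge (f : E) (i : Fin m) :
    v (b.repr f i) ^ m * exp (r : ℤ) ^ (i : ℕ) ≤ gauge v b r f :=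
  Finset.le_sup (f := fun i : Fin m ↦ v (b.repr f i) ^ m * exp (r : ℤ) ^ (i : ℕ))
    (Finset.mem_univ i)

theorem gauge_le_iff {f : E} {c : WithZero (Multiplicative ℤ)} :
    gauge v b r f ≤ c ↔ ∀ i : Fin m, v (b.repr f i) ^ m * exp (r : ℤ) ^ (i : ℕ) ≤ c := by
  simp [gauge]

theorem gauge_lt_iff {f : E} {c : WithZero (Multiplicative ℤ)} (hc : 0 < c) :
    gauge v b r f < c ↔ ∀ i : Fin m, v (b.repr f i) ^ m * exp (r : ℤ) ^ (i : ℕ) < c := by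
  simp [gauge, Finset.sup_lt_iff (show ⊥ < c from hc)]

theorem gauge_zero (hm : m ≠ 0) : gauge v b r 0 = 0 :=
  le_antisymm (gauge_le_iff.mpr fun i ↦ by simp [hm]) zero_le

theorem gauge_neg (f : E) : gauge v b r (-f) = gauge v b r f := by
  simp [gauge, Valuation.map_neg]

theorem gauge_pos {f : E} (hf : f ≠ 0) : 0 < gauge v b r f := by
  obtain ⟨i, hi⟩ : ∃ i, b.repr f i ≠ 0 := by
    by_contra! h
    exact hf (b.repr.map_eq_zero_iff.mp (Finsupp.ext h))
  exact lt_of_lt_of_le (zero_lt_iff.mpr (by simp [hi])) (le_gauge f i)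

theorem gauge_add_le (f g : E) :
    gauge v b r (f + g) ≤ max (gauge v b r f) (gauge v b r g) := by
  refine gauge_le_iff.mpr fun i ↦ ?_
  rw [map_add, Finsupp.add_apply]
  rcases le_max_iff.mp (v.map_add (b.repr f i) (b.repr g i)) with h | h
  · exact le_max_of_le_left (le_trans (by gcongr) (le_gauge f i))
  · exact le_max_of_le_right (le_trans (by gcongr) (le_gauge g i))

theorem gauge_sum_le (hm : m ≠ 0) {ι : Type*} (s : Finset ι) (f : ι → E)
    {c : WithZero (Multiplicative ℤ)} (h : ∀ i ∈ s, gauge v b r (f i) ≤ c) :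
    gauge v b r (∑ i ∈ s, f i) ≤ c := by
  classical
  induction s using Finset.induction_on with
  | empty => simp [gauge_zero hm]
  | insert a s ha ih =>
    rw [Finset.sum_insert ha]
    exact (gauge_add_le _ _).trans (max_le (h a (by simp)) (ih fun i hi ↦ h i (by simp [hi])))

theorem gauge_smul_basis (a : F) (i : Fin m) :
    gauge v b r (a • b i) = v a ^ m * exp (r : ℤ) ^ (i : ℕ) := by
  have hm : m ≠ 0 := by have := i.2; omega
  refine le_antisymm (gauge_le_iff.mpr fun j ↦ ?_) ?_
  · by_cases h : i = j
    · subst h; simp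
    · simp [h, hm]
  · simpa using le_gauge (v := v) (b := b) (r := r) (a • b i) i

variable {y : E} {u : F}

theorem gauge_monomial (hm : m ≠ 0) (hb : ∀ i, b i = y ^ (i : ℕ)) (hy : y ^ m = algebraMap F E u)
    (hu : v u = exp (r : ℤ)) (a : F) (k : ℕ) :
    gauge v b r (a • y ^ k) = v a ^ m * exp (r : ℤ) ^ k := by
  have hk : a • y ^ k = (a * u ^ (k / m)) • b ⟨k % m, Nat.mod_lt _ (by omega)⟩ := by
    conv_lhs => rw [← Nat.div_add_mod k m]
    rw [hb, pow_add, pow_mul, hy, mul_smul, ← map_pow, ← Algebra.smul_def]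
  rw [hk, gauge_smul_basis, map_mul, map_pow, hu]
  conv_rhs => rw [← Nat.div_add_mod k m]
  rw [mul_pow, pow_add, pow_mul, mul_assoc]
  congr 2
  rw [← pow_mul, ← pow_mul, mul_comm]

theorem exists_gauge_sub_lt (hmr : m.Coprime r) (hb : ∀ i, b i = y ^ (i : ℕ)) {f : E}
    (hf : f ≠ 0) :
    ∃ (a : F) (k : ℕ), gauge v b r f = v a ^ m * exp (r : ℤ) ^ k ∧
      gauge v b r (f - a • y ^ k) < gauge v b r f := by
  have hpos := gauge_pos (v := v) (b := b) (r := r) hf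
  have hne : Nonempty (Fin m) := by
    by_contra h
    rw [not_nonempty_iff] at h
    simp [gauge] at hpos
  obtain ⟨i, -, hi⟩ := Finset.exists_mem_eq_sup Finset.univ Finset.univ_nonempty
    fun i : Fin m ↦ v (b.repr f i) ^ m * exp (r : ℤ) ^ (i : ℕ)
  change gauge v b r f = _ at hi
  have hm : m ≠ 0 := by have := i.2; omega
  refine ⟨b.repr f i, i, hi, (gauge_lt_iff hpos).mpr fun j ↦ ?_⟩
  rw [← hb, map_sub, map_smul, b.repr_self, Finsupp.smul_single, smul_eq_mul, mul_one,
    Finsupp.sub_apply]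
  by_cases h : i = j
  · subst h
    simpa [hm] using hpos
  rw [Finsupp.single_eq_of_ne (Ne.symm h), sub_zero]
  refine lt_of_le_of_ne (le_gauge f j) fun hj ↦ h (Fin.ext ?_)
  refine WithZero.eq_of_pow_mul_exp_pow_eq hmr i.2 j.2 ?_ ?_ (hi.symm.trans hj.symm)
  · rintro h0
    simp [hi, h0, hm] at hpos
  · rintro h0
    simp [← hj, h0, hm] at hpos

theorem gauge_mul_le (hm : m ≠ 0) (hb : ∀ i, b i = y ^ (i : ℕ)) (hy : y ^ m = algebraMap F E u)
    (hu : v u = exp (r : ℤ)) (f g : E) :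
    gauge v b r (f * g) ≤ gauge v b r f * gauge v b r g := by
  conv_lhs => rw [← b.sum_repr f, ← b.sum_repr g, Finset.sum_mul_sum]
  refine gauge_sum_le hm _ _ fun i _ ↦ gauge_sum_le hm _ _ fun j _ ↦ ?_
  rw [hb, hb, smul_mul_smul_comm, ← pow_add, gauge_monomial hm hb hy hu, map_mul, mul_pow, pow_add,
    mul_mul_mul_comm]
  exact mul_le_mul' (le_gauge f i) (le_gauge g j)

theorem gauge_mul (hm : m ≠ 0) (hmr : m.Coprime r) (hb : ∀ i, b i = y ^ (i : ℕ))
    (hy : y ^ m = algebraMap F E u) (hu : v u = exp (r : ℤ)) (f g : E) :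
    gauge v b r (f * g) = gauge v b r f * gauge v b r g := by
  rcases eq_or_ne f 0 with rfl | hf
  · simp [gauge_zero hm]
  rcases eq_or_ne g 0 with rfl | hg
  · simp [gauge_zero hm]
  refine le_antisymm (gauge_mul_le hm hb hy hu f g) ?_
  have hfpos := gauge_pos (v := v) (b := b) (r := r) hf
  have hgpos := gauge_pos (v := v) (b := b) (r := r) hg
  obtain ⟨a, k, hak, hf'⟩ := exists_gauge_sub_lt (v := v) hmr hb hf
  obtain ⟨c, l, hcl, hg'⟩ := exists_gauge_sub_lt (v := v) hmr hb hg
  set f₀ := a • y ^ k with hf₀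
  set g₀ := c • y ^ l with hg₀
  have hlead : gauge v b r (f₀ * g₀) = gauge v b r f * gauge v b r g := by
    rw [hf₀, hg₀, smul_mul_smul_comm, ← pow_add, gauge_monomial hm hb hy hu, hak, hcl, map_mul,
      mul_pow, pow_add, mul_mul_mul_comm]
  have hf₀g : gauge v b r f₀ = gauge v b r f := by rw [hf₀, gauge_monomial hm hb hy hu, hak]
  have hrest : gauge v b r (-(f₀ * (g - g₀) + (f - f₀) * g)) < gauge v b r f * gauge v b r g := by
    rw [gauge_neg]
    refine (gauge_add_le _ _).trans_lt (max_lt ?_ ?_)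
    · refine (gauge_mul_le hm hb hy hu _ _).trans_lt ?_
      rw [hf₀g]
      exact mul_lt_mul_of_pos_left hg' hfpos
    · exact (gauge_mul_le hm hb hy hu _ _).trans_lt (mul_lt_mul_of_pos_right hf' hgpos)
  have hle := gauge_add_le (v := v) (b := b) (r := r) (f * g) (-(f₀ * (g - g₀) + (f - f₀) * g))
  rw [show f * g + -(f₀ * (g - g₀) + (f - f₀) * g) = f₀ * g₀ by ring, hlead] at hle
  exact (le_max_iff.mp hle).resolve_right hrest.not_ge

/-- A discrete valuation `v` on `F` is totally ramified in `E = F(y)`, of degree `m`, if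
`y ^ m = u` with `v u` prime to `m`. -/
theorem existsUnique_valuation (hm : m ≠ 0) (hmr : m.Coprime r) (hb : ∀ i, b i = y ^ (i : ℕ))
    (hy : y ^ m = algebraMap F E u) (hu : v u = exp (r : ℤ)) (hv : Function.Surjective v) :
    ∃! w : Valuation E (WithZero (Multiplicative ℤ)),
      Function.Surjective w ∧ ∀ a : F, w (algebraMap F E a) = v a ^ m := by
  have hmon := gauge_monomial (v := v) hm hb hy hu
  let w : Valuation E (WithZero (Multiplicative ℤ)) :=
    { toFun := gauge v b r
      map_zero' := gauge_zero hm
      map_one' := by simpa using hmon 1 0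
      map_mul' := gauge_mul hm hmr hb hy hu
      map_add_le_max' := gauge_add_le }
  have hw (f : E) : w f = gauge v b r f := rfl
  have hwF (a : F) : w (algebraMap F E a) = v a ^ m := by
    simpa [hw, Algebra.algebraMap_eq_smul_one] using hmon a 0
  refine ⟨w, ⟨fun x ↦ ?_, hwF⟩, fun w' ⟨_, hw'⟩ ↦ Valuation.ext fun f ↦ ?_⟩
  · rcases eq_or_ne x 0 with rfl | hx
    · exact ⟨0, map_zero w⟩
    obtain ⟨s, t, hst⟩ : IsCoprime (m : ℤ) r := Nat.isCoprime_iff_coprime.mpr hmr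
    obtain ⟨a, ha⟩ := hv (exp 1)
    have hwy : w y = exp (r : ℤ) := by simpa [hw] using hmon 1 1
    refine ⟨algebraMap F E a ^ (s * log x) * y ^ (t * log x), ?_⟩
    rw [map_mul, map_zpow₀, map_zpow₀, hwF, ha, hwy, ← exp_nsmul, ← exp_zsmul, ← exp_zsmul,
      ← exp_add]
    conv_rhs => rw [← exp_log hx]
    congr 1
    simp only [smul_eq_mul, nsmul_eq_mul]
    linear_combination log x * hst
  · have hw'y : w' y = exp (r : ℤ) := by
      refine (pow_left_inj₀ zero_le zero_le hm).mp ?_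
      rw [← map_pow, hy, hw', hu]
    have hw'mon (a : F) (k : ℕ) : w' (a • y ^ k) = v a ^ m * exp (r : ℤ) ^ k := by
      rw [Algebra.smul_def, map_mul, map_pow, hw', hw'y]
    have hle (f : E) : w' f ≤ w f := by
      conv_lhs => rw [← b.sum_repr f]
      refine w'.map_sum_le fun i _ ↦ ?_
      rw [hb, hw'mon]
      exact le_gauge f i
    rcases eq_or_ne f 0 with rfl | hf
    · simp
    obtain ⟨a, k, hak, hlt⟩ := exists_gauge_sub_lt (v := v) hmr hb hf
    rw [hw, hak, ← hw'mon]
    have : w' (f - a • y ^ k) < w' (a • y ^ k) := by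
      rw [hw'mon, ← hak]
      exact (hle _).trans_lt hlt
    simpa using w'.map_add_eq_of_lt_right this

end KummerRamification

open WithZero in
theorem RatFunc.inftyValuation_surjective (K : Type*) [Field K] [DecidableEq (RatFunc K)] :
    Function.Surjective (RatFunc.inftyValuation K) := by
  intro x
  rcases eq_or_ne x 0 with rfl | hx
  · exact ⟨0, map_zero _⟩
  · refine ⟨RatFunc.X ^ log x, ?_⟩
    rw [map_zpow₀, RatFunc.inftyValuation.X, ← exp_zsmul]
    simp [exp_log hx]

open WithZero in
theorem RatFunc.inftyValuation_div_eq_exp {K : Type*} [Field K] [DecidableEq (RatFunc K)]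
    {p q : Polynomial K} (hp : p ≠ 0) (hq : q ≠ 0) :
    RatFunc.inftyValuation K
      (algebraMap (Polynomial K) (RatFunc K) p / algebraMap (Polynomial K) (RatFunc K) q) =
      exp ((p.natDegree : ℤ) - q.natDegree) := by
  rw [map_div₀, RatFunc.inftyValuation_apply, RatFunc.inftyValuation_apply,
    RatFunc.inftyValuation.polynomial K hp, RatFunc.inftyValuation.polynomial K hq, exp_sub]


/-- Let `K` be a field containing a primitive `m`-th root of unity, `F = K(x)`,
`u = b₁(x)/b₂(x)` with `b₁, b₂` coprime, `deg b₁ = m`, `deg b₂ = m - r`, `gcd(m,r)=1`,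
and let `E = F(y)` with `y^m = u` and `[E : F] = m`. Then the place at infinity of `F`
is totally ramified in `E/F`: there is a unique valuation `w` on `E` that is surjective
and satisfies `w(a) = v_∞(a)^m` for `a ∈ F`, i.e. a unique place above `v_∞`, with
ramification index `m`. -/
theorem stmt_14 (m r : ℕ) (hm : 2 ≤ m) (hr : 1 ≤ r) (hrm : r ≤ m) (hgcd : Nat.gcd m r = 1)
    (K : Type*) [Field K] [DecidableEq (RatFunc K)] (hchar : ¬ (ringChar K : ℕ) ∣ m)
    (ζ : K) (hζ : IsPrimitiveRoot ζ m)
    (b₁ b₂ : Polynomial K) (hcop : IsCoprime b₁ b₂)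
    (hd1 : b₁.natDegree = m) (hd2 : b₂.natDegree = m - r)
    (E : Type*) [Field E] [Algebra (RatFunc K) E]
    (y : E)
    (hy : y ^ m = algebraMap (RatFunc K) E
      (algebraMap (Polynomial K) (RatFunc K) b₁ / algebraMap (Polynomial K) (RatFunc K) b₂))
    (hgen : Algebra.adjoin (RatFunc K) {y} = ⊤)
    (hdeg : Module.finrank (RatFunc K) E = m) :
    ∃! w : Valuation E (WithZero (Multiplicative ℤ)),
      Function.Surjective w ∧
      ∀ a : RatFunc K, w (algebraMap (RatFunc K) E a) = (FunctionField.inftyValuation K a) ^ m := by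
  have hm0 : m ≠ 0 := by omega
  have hrm' : r ≠ m := by
    rintro rfl
    rw [Nat.gcd_self] at hgcd
    omega
  have hb₁ : b₁ ≠ 0 := Polynomial.ne_zero_of_natDegree_gt (n := 0) (by omega)
  have hb₂ : b₂ ≠ 0 := Polynomial.ne_zero_of_natDegree_gt (n := 0) (by omega)
  have hu := RatFunc.inftyValuation_div_eq_exp hb₁ hb₂
  rw [hd1, hd2, show (m : ℤ) - ((m - r : ℕ) : ℤ) = r by omega] at hu
  have : FiniteDimensional (RatFunc K) E := Module.finite_of_finrank_pos (by omega)
  let pb := PowerBasis.ofAdjoinEqTop (Algebra.IsIntegral.isIntegral (R := RatFunc K) y) hgen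
  have hdim : pb.dim = m := pb.finrank.symm.trans hdeg
  refine KummerRamification.existsUnique_valuation (b := pb.basis.reindex (finCongr hdim)) hm0 hgcd
    (fun i ↦ ?_) hy hu (RatFunc.inftyValuation_surjective K)
  rw [Module.Basis.reindex_apply, pb.basis_eq_pow]
  rfl
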